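/- For every u ∈ ℂ^g, the family indexed by n ∈ ℤ^g with terms exp(πi·nᵀBn + 2πi·nᵀu) is summable (the theta series converges absolutely). -/

import Mathlib

open Complex Matrix

/-- The term of the Riemann theta series associated with `B`, indexed by `n ∈ ℤ^g`. -/
noncomputable def thetaTerm (g : ℕ) (B : Matrix (Fin g) (Fin g) ℂ)
    (u : Fin g → ℂ) (n : Fin g → ℤ) : ℂ :=
  Complex.exp (Real.pi * Complex.I * (∑ i, ∑ j, (n i : ℂ) * B i j * (n j : ℂ))
    + 2 * Real.pi * Complex.I * (∑ i, (n i : ℂ) * u i))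

/-- The Riemann theta function associated with `B`. -/
noncomputable def theta (g : ℕ) (B : Matrix (Fin g) (Fin g) ℂ) (u : Fin g → ℂ) : ℂ :=
  ∑' n : Fin g → ℤ, thetaTerm g B u n

/-- A product of nonnegative summable functions of the separate coordinates is summable. -/
lemma summable_pi_prod_of_nonneg {α : Type*} : ∀ {g : ℕ} (f : Fin g → α → ℝ),
    (∀ i a, 0 ≤ f i a) → (∀ i, Summable (f i)) →
    Summable (fun n : Fin g → α => ∏ i, f i (n i))
  | 0, _, _, _ => (hasSum_fintype _).summable
  | g + 1, f, hf, hs => by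
    have ih := summable_pi_prod_of_nonneg (fun i : Fin g => f i.succ)
      (fun i => hf i.succ) (fun i => hs i.succ)
    have h := (hs 0).mul_of_nonneg ih (hf 0)
      (fun n => Finset.prod_nonneg fun i _ => hf i.succ (n i))
    rw [← (Fin.consEquiv fun _ : Fin (g + 1) => α).summable_iff]
    refine h.congr fun p => ?_
    simp [Fin.prod_univ_succ, Fin.consEquiv]

/-- A positive definite real quadratic form dominates a positive multiple of the sum of squares. -/
lemma Matrix.PosDef.exists_mul_sum_sq_le {ι : Type*} [Fintype ι] {Y : Matrix ι ι ℝ}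
    (hY : Y.PosDef) :
    ∃ c : ℝ, 0 < c ∧ ∀ x : ι → ℝ, c * ∑ i, x i ^ 2 ≤ x ⬝ᵥ Y *ᵥ x := by
  have hpos : ∀ x : ι → ℝ, x ≠ 0 → 0 < x ⬝ᵥ Y *ᵥ x := fun x hx => by
    simpa using hY.dotProduct_mulVec_pos hx
  have hcont : Continuous fun x : ι → ℝ => x ⬝ᵥ Y *ᵥ x := by fun_prop
  obtain hι | hι := isEmpty_or_nonempty ι
  · exact ⟨1, one_pos, fun x => by simp [dotProduct]⟩
  obtain ⟨x₀, hx₀, hmin⟩ := (isCompact_sphere (0 : ι → ℝ) 1).exists_isMinOn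
    (NormedSpace.sphere_nonempty.2 zero_le_one) hcont.continuousOn
  have hx₀' : x₀ ≠ 0 := by
    rintro rfl
    simp at hx₀
  have hm := hpos x₀ hx₀'
  have hcard : (0 : ℝ) < Fintype.card ι := by exact_mod_cast Fintype.card_pos
  refine ⟨(x₀ ⬝ᵥ Y *ᵥ x₀) / Fintype.card ι, div_pos hm hcard, fun x => ?_⟩
  obtain rfl | hx := eq_or_ne x 0
  · simp
  have hnx : 0 < ‖x‖ := norm_pos_iff.2 hx
  have hsphere : ‖x‖⁻¹ • x ∈ Metric.sphere (0 : ι → ℝ) 1 := by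
    simp [norm_smul, hnx.ne']
  have h1 : x₀ ⬝ᵥ Y *ᵥ x₀ ≤ (‖x‖⁻¹ • x) ⬝ᵥ Y *ᵥ (‖x‖⁻¹ • x) := hmin hsphere
  have h2 : (x₀ ⬝ᵥ Y *ᵥ x₀) * ‖x‖ ^ 2 ≤ x ⬝ᵥ Y *ᵥ x := by
    rw [mulVec_smul, smul_dotProduct, dotProduct_smul, smul_eq_mul, smul_eq_mul] at h1
    calc _ ≤ (‖x‖⁻¹ * (‖x‖⁻¹ * (x ⬝ᵥ Y *ᵥ x))) * ‖x‖ ^ 2 := by gcongr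
      _ = _ := by field_simp
  have h3 : ∑ i, x i ^ 2 ≤ Fintype.card ι * ‖x‖ ^ 2 := by
    calc ∑ i, x i ^ 2 ≤ ∑ _i : ι, ‖x‖ ^ 2 := Finset.sum_le_sum fun i _ => by
          rw [← sq_abs]
          exact pow_le_pow_left₀ (abs_nonneg _) (norm_le_pi_norm x i) 2
      _ = _ := by simp
  calc _ ≤ (x₀ ⬝ᵥ Y *ᵥ x₀) / Fintype.card ι * (Fintype.card ι * ‖x‖ ^ 2) := by gcongr
    _ = (x₀ ⬝ᵥ Y *ᵥ x₀) * ‖x‖ ^ 2 := by field_simp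
    _ ≤ _ := h2

lemma norm_thetaTerm (g : ℕ) (B : Matrix (Fin g) (Fin g) ℂ) (u : Fin g → ℂ) (n : Fin g → ℤ) :
    ‖thetaTerm g B u n‖ =
      Real.exp (-Real.pi * ((fun i => (n i : ℝ)) ⬝ᵥ B.map Complex.im *ᵥ fun i => (n i : ℝ))
        - 2 * Real.pi * ∑ i, (n i : ℝ) * (u i).im) := by
  rw [thetaTerm, Complex.norm_exp]
  congr 1
  have hB : (∑ i, ∑ j, (n i : ℂ) * B i j * (n j : ℂ)).im =
      (fun i => (n i : ℝ)) ⬝ᵥ B.map Complex.im *ᵥ fun i => (n i : ℝ) := by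
    simp [dotProduct, mulVec, Finset.mul_sum, mul_assoc]
  have hu : (∑ i, (n i : ℂ) * u i).im = ∑ i, (n i : ℝ) * (u i).im := by simp
  rw [← hB, ← hu]
  generalize (∑ i, ∑ j, (n i : ℂ) * B i j * (n j : ℂ)) = z
  generalize (∑ i, (n i : ℂ) * u i) = w
  simp
  ring

/-- the theta series converges absolutely: for every `u ∈ ℂ^g` the family
`n ↦ exp(πi·nᵀBn + 2πi·nᵀu)`, `n ∈ ℤ^g`, is summable. -/
theorem theta_summable (g : ℕ) (hg : 0 < g) (B : Matrix (Fin g) (Fin g) ℂ)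
    (hBsymm : B.IsSymm) (hBim : (B.map Complex.im).PosDef)
    (u : Fin g → ℂ) :
    Summable (fun n : Fin g → ℤ => thetaTerm g B u n) := by
  obtain ⟨c, hc, hle⟩ := hBim.exists_mul_sum_sq_le
  have hs := summable_pi_prod_of_nonneg
    (fun (i : Fin g) (k : ℤ) =>
      Real.exp (-Real.pi * (c * (k : ℝ) ^ 2 - 2 * |(u i).im| * |(k : ℝ)|)))
    (fun _ _ => (Real.exp_pos _).le)
    (fun i => by simpa using summable_pow_mul_jacobiTheta₂_term_bound |(u i).im| hc 0)
  refine hs.of_norm_bounded fun n => ?_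
  rw [norm_thetaTerm, ← Real.exp_sum, Real.exp_le_exp]
  have h1 := hle fun i => (n i : ℝ)
  have h2 : -∑ i, (n i : ℝ) * (u i).im ≤ ∑ i, |(u i).im| * |(n i : ℝ)| := by
    rw [← Finset.sum_neg_distrib]
    refine Finset.sum_le_sum fun i _ => ?_
    rw [mul_comm, ← abs_mul]
    exact neg_le_abs _
  have h3 : ∑ i, -Real.pi * (c * (n i : ℝ) ^ 2 - 2 * |(u i).im| * |(n i : ℝ)|) =
      -Real.pi * (c * ∑ i, (n i : ℝ) ^ 2) +
        2 * Real.pi * ∑ i, |(u i).im| * |(n i : ℝ)| := by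
    simp only [Finset.mul_sum, ← Finset.sum_add_distrib]
    exact Finset.sum_congr rfl fun i _ => by ring
  rw [h3]
  have h4 := mul_le_mul_of_nonneg_left h1 Real.pi_pos.le
  have h5 := mul_le_mul_of_nonneg_left h2 Real.two_pi_pos.le
  linarith
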